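/- Let θ > 0 be a constant such that for any i, l ∈ Σ with i|n ≠ l|n, inf_{a,b∈[0,1]²} d(S_{i|n}(a), S_{l|n}(b)) ≥ θ α₂(D_{Π(σ^{n−1}i)} S_{i|n−1}). Then for every i ∈ Σ, every n ∈ ℕ and x = Π(i), the square Q₂(x, θ α₂(D_{Π(σⁿi)} S_{i|n})) intersects S_{j}([0,1]²) for no word j ∈ Iⁿ other than j = i|n; consequently Q₂(x, θ α₂(D_{Π(σⁿi)} S_{i|n})) ∩ F ⊆ B_n(x, θ α₂(D_{Π(σⁿi)} S_{i|n})). -/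

import Mathlib

open MeasureTheory Filter Set

noncomputable section

namespace FFL

/-- The unit square `[0,1]² ⊆ ℝ²`. -/
def sq : Set (ℝ × ℝ) := Set.Icc (0:ℝ) 1 ×ˢ Set.Icc (0:ℝ) 1

/-- The Euclidean metric on `ℝ²`. -/
def dE (a b : ℝ × ℝ) : ℝ := Real.sqrt ((a.1 - b.1) ^ 2 + (a.2 - b.2) ^ 2)

/-- Squared Frobenius norm of a 2×2 real matrix. -/
def frobSq (A : Matrix (Fin 2) (Fin 2) ℝ) : ℝ := ∑ i, ∑ j, (A i j) ^ 2

/-- The larger singular value `α₁` of a 2×2 real matrix, i.e. the larger positive square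
root of the eigenvalues of `AᵀA`, via the standard closed formula. -/
def sv1 (A : Matrix (Fin 2) (Fin 2) ℝ) : ℝ :=
  Real.sqrt ((frobSq A + Real.sqrt ((frobSq A) ^ 2 - 4 * (A.det) ^ 2)) / 2)

/-- The smaller singular value `α₂` of a 2×2 real matrix. -/
def sv2 (A : Matrix (Fin 2) (Fin 2) ℝ) : ℝ :=
  Real.sqrt ((frobSq A - Real.sqrt ((frobSq A) ^ 2 - 4 * (A.det) ^ 2)) / 2)

/-- The nonlinear, non-conformal iterated function systems of Falconer, Fraser and Lee:
maps `S i (a₁,a₂) = (f i a₁, g i (a₁,a₂))` on the unit square, where `f i`, `g i` are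
`C^{1+α}` contractions (with partial derivatives `fx`, `gx`, `gy`) satisfying the
domination condition. -/
structure System (I : Type) [Fintype I] where
  f : I → ℝ → ℝ
  g : I → ℝ × ℝ → ℝ
  fx : I → ℝ → ℝ
  gx : I → ℝ × ℝ → ℝ
  gy : I → ℝ × ℝ → ℝ
  /-- the index set has at least two elements -/
  card2 : 2 ≤ Fintype.card I
  /-- each `S i` maps the unit square into itself -/
  mapsTo : ∀ i, Set.MapsTo (fun a => (f i a.1, g i a)) sq sq
  /-- `fx i` is the derivative of `f i` on `[0,1]` -/
  hasDeriv_f : ∀ i, ∀ x ∈ Set.Icc (0:ℝ) 1,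
    HasDerivWithinAt (f i) (fx i x) (Set.Icc (0:ℝ) 1) x
  /-- `(gx i, gy i)` is the (total) derivative of `g i` on the unit square -/
  hasDeriv_g : ∀ i, ∀ a ∈ sq, HasFDerivWithinAt (g i)
      (gx i a • ContinuousLinearMap.fst ℝ ℝ ℝ + gy i a • ContinuousLinearMap.snd ℝ ℝ ℝ) sq a
  /-- the derivatives are `α`-Hölder for some `α > 0`, i.e. `f i`, `g i` are `C^{1+α}` -/
  holder : ∃ α > (0:ℝ), ∃ H > (0:ℝ), ∀ i,
      (∀ x ∈ Set.Icc (0:ℝ) 1, ∀ y ∈ Set.Icc (0:ℝ) 1, |fx i x - fx i y| ≤ H * |x - y| ^ α) ∧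
      (∀ a ∈ sq, ∀ b ∈ sq, |gx i a - gx i b| ≤ H * dE a b ^ α) ∧
      (∀ a ∈ sq, ∀ b ∈ sq, |gy i a - gy i b| ≤ H * dE a b ^ α)
  /-- the maps `f i`, `g i` (hence `S i`) are uniform contractions -/
  contracting : ∃ c, 0 ≤ c ∧ c < 1 ∧ ∀ i,
      (∀ x ∈ Set.Icc (0:ℝ) 1, ∀ y ∈ Set.Icc (0:ℝ) 1, |f i x - f i y| ≤ c * |x - y|) ∧
      (∀ a ∈ sq, ∀ b ∈ sq, |g i a - g i b| ≤ c * dE a b) ∧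
      (∀ a ∈ sq, ∀ b ∈ sq, dE (f i a.1, g i a) (f i b.1, g i b) ≤ c * dE a b)
  /-- the domination condition:
  `inf |f_{i,x}| > sup |g_{i,y}| ≥ inf |g_{i,y}| ≥ d > 0` -/
  domination : ∃ d > (0:ℝ), ∀ i,
      d ≤ sInf ((fun a => |gy i a|) '' sq) ∧
      sSup ((fun a => |gy i a|) '' sq) < sInf ((fun x => |fx i x|) '' Set.Icc (0:ℝ) 1)

variable {I : Type} [Fintype I]

/-- The map `S i`. -/
def S (T : System I) (i : I) (a : ℝ × ℝ) : ℝ × ℝ := (T.f i a.1, T.g i a)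

/-- The composition `S_w = S_{i₁} ∘ ⋯ ∘ S_{i_n}` along a finite word `w = (i₁,…,i_n)`. -/
def Sw (T : System I) : List I → ℝ × ℝ → ℝ × ℝ
  | [], a => a
  | i :: w, a => S T i (Sw T w a)

/-- The top-left entry `f_{w,x}(a)` of the (lower triangular) Jacobian `D_a S_w`,
via the chain rule. -/
def fxw (T : System I) : List I → ℝ × ℝ → ℝ
  | [], _ => 1
  | i :: w, a => T.fx i (Sw T w a).1 * fxw T w a

/-- The bottom-right entry `g_{w,y}(a)` of the Jacobian `D_a S_w`. -/
def gyw (T : System I) : List I → ℝ × ℝ → ℝ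
  | [], _ => 1
  | i :: w, a => T.gy i (Sw T w a) * gyw T w a

/-- The off-diagonal entry `g_{w,x}(a)` of the Jacobian `D_a S_w`. -/
def gxw (T : System I) : List I → ℝ × ℝ → ℝ
  | [], _ => 0
  | i :: w, a => T.gx i (Sw T w a) * fxw T w a + T.gy i (Sw T w a) * gxw T w a

/-- The Jacobian matrix `D_a S_w`. -/
def Dmat (T : System I) (w : List I) (a : ℝ × ℝ) : Matrix (Fin 2) (Fin 2) ℝ :=
  !![fxw T w a, 0; gxw T w a, gyw T w a]

/-- The larger singular value `α₁(D_a S_w)`. -/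
def alpha1 (T : System I) (w : List I) (a : ℝ × ℝ) : ℝ := sv1 (Dmat T w a)

/-- The smaller singular value `α₂(D_a S_w)`. -/
def alpha2 (T : System I) (w : List I) (a : ℝ × ℝ) : ℝ := sv2 (Dmat T w a)

/-- The restriction `i|n` of an infinite sequence to its first `n` symbols. -/
def word (ii : ℕ → I) (n : ℕ) : List I := List.ofFn (fun k : Fin n => ii k.1)

/-- The iterated left shift `σⁿ`. -/
def shiftn (ii : ℕ → I) (n : ℕ) : ℕ → I := fun k => ii (k + n)

/-- The left shift `σ` on `Σ = I^ℕ`. -/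
def shift (ii : ℕ → I) : ℕ → I := fun k => ii (k + 1)

/-- The cylinder set `[w] ⊆ Σ` of a finite word `w`. -/
def cyl (w : List I) : Set (ℕ → I) := {jj | ∀ k : Fin w.length, jj k.1 = w.get k}

/-- `F` is the attractor of the IFS: the (unique) nonempty compact subset of the unit
square with `F = ⋃ i, S i '' F`. -/
def IsAttractor (T : System I) (F : Set (ℝ × ℝ)) : Prop :=
  F.Nonempty ∧ IsCompact F ∧ F ⊆ sq ∧ F = ⋃ i, S T i '' F

/-- The strong separation condition: the sets `S i '' F` are pairwise disjoint. -/
def SSC (T : System I) (F : Set (ℝ × ℝ)) : Prop :=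
  ∀ i j : I, i ≠ j → Disjoint (S T i '' F) (S T j '' F)

/-- `Pi` is the canonical coding map `Π : Σ → [0,1]²`:
`Π(i)` is the unique point of `⋂ₙ S_{i|n}([0,1]²)`. -/
def IsCoding (T : System I) (Pi : (ℕ → I) → ℝ × ℝ) : Prop :=
  ∀ ii : ℕ → I, ∀ n : ℕ, Pi ii ∈ Sw T (word ii n) '' sq

/-- `m` is quasi-Bernoulli with constant `L`:
`L⁻¹ m[w] m[v] ≤ m[wv] ≤ L m[w] m[v]` for all finite words `w, v`. -/
def QuasiBernoulli [MeasurableSpace I] (m : Measure (ℕ → I)) (L : ℝ) : Prop :=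
  0 < L ∧ ∀ w v : List I,
    L⁻¹ * (m (cyl w)).toReal * (m (cyl v)).toReal ≤ (m (cyl (w ++ v))).toReal ∧
    (m (cyl (w ++ v))).toReal ≤ L * (m (cyl w)).toReal * (m (cyl v)).toReal

/-- The interval `Q₁(x,r) = [x - r/2, x + r/2]`. -/
def Q1 (x r : ℝ) : Set ℝ := Set.Icc (x - r / 2) (x + r / 2)

/-- The square `Q₂(a,r) = (a₁ - r/2, a₁ + r/2) × (a₂ - r/2, a₂ + r/2)`. -/
def Q2 (a : ℝ × ℝ) (r : ℝ) : Set (ℝ × ℝ) :=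
  Set.Ioo (a.1 - r / 2) (a.1 + r / 2) ×ˢ Set.Ioo (a.2 - r / 2) (a.2 + r / 2)

/-- The approximate square `B_n(a,r)`: points `b ∈ S_w([0,1]²)` with `|b₁ - a₁| ≤ r/2`. -/
def Bn (T : System I) (w : List I) (a : ℝ × ℝ) (r : ℝ) : Set (ℝ × ℝ) :=
  {b ∈ Sw T w '' sq | |b.1 - a.1| ≤ r / 2}

/-- The closed Euclidean ball in `ℝ²`. -/
def ballE (x : ℝ × ℝ) (r : ℝ) : Set (ℝ × ℝ) := {y | dE x y ≤ r}

/-- A measure on `ℝ` is exact dimensional with dimension `s` if for a.e. `x`,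
`log ν(B(x,r)) / log r → s` as `r → 0⁺`. -/
def ExactDim1 (ν : Measure ℝ) (s : ℝ) : Prop :=
  ∀ᵐ x ∂ν, Tendsto (fun r => Real.log (ν (Metric.closedBall x r)).toReal / Real.log r)
    (nhdsWithin 0 (Set.Ioi 0)) (nhds s)

/-- A measure on `ℝ²` is exact dimensional with dimension `s` (w.r.t. Euclidean balls). -/
def ExactDim2 (ν : Measure (ℝ × ℝ)) (s : ℝ) : Prop :=
  ∀ᵐ x ∂ν, Tendsto (fun r => Real.log (ν (ballE x r)).toReal / Real.log r)
    (nhdsWithin 0 (Set.Ioi 0)) (nhds s)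

/-- `η = sup_{i ∈ I, a, b ∈ [0,1]²} |g_{i,y}(a)| / |f_{i,x}(b)|`. -/
def eta (T : System I) : ℝ :=
  sSup {x : ℝ | ∃ i : I, ∃ a ∈ sq, ∃ b ∈ sq, x = |T.gy i a| / |T.fx i b.1|}

end FFL

open FFL

namespace FFL

lemma dE_nonneg (a b : ℝ × ℝ) : 0 ≤ dE a b := Real.sqrt_nonneg _

lemma dE_sq (a b : ℝ × ℝ) : dE a b ^ 2 = (a.1 - b.1) ^ 2 + (a.2 - b.2) ^ 2 :=
  Real.sq_sqrt (by positivity)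

lemma eq_of_dE_eq_zero {a b : ℝ × ℝ} (h : dE a b = 0) : a = b := by
  have h1 := dE_sq a b
  rw [h] at h1
  have h2 : a.1 - b.1 = 0 := by nlinarith [sq_nonneg (a.1 - b.1), sq_nonneg (a.2 - b.2)]
  have h3 : a.2 - b.2 = 0 := by nlinarith [sq_nonneg (a.1 - b.1), sq_nonneg (a.2 - b.2)]
  exact Prod.ext (sub_eq_zero.mp h2) (sub_eq_zero.mp h3)

lemma dE_le_two_of_mem_sq {a b : ℝ × ℝ} (ha : a ∈ sq) (hb : b ∈ sq) : dE a b ≤ 2 := by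
  obtain ⟨⟨h1, h2⟩, h3, h4⟩ := ha
  obtain ⟨⟨k1, k2⟩, k3, k4⟩ := hb
  have h5 : (a.1 - b.1) ^ 2 ≤ 1 := by
    rw [sq_le_one_iff_abs_le_one, abs_le]; constructor <;> linarith
  have h6 : (a.2 - b.2) ^ 2 ≤ 1 := by
    rw [sq_le_one_iff_abs_le_one, abs_le]; constructor <;> linarith
  nlinarith [dE_sq a b]

/-! ### Singular values of 2×2 matrices -/

lemma frobSq_eq (A : Matrix (Fin 2) (Fin 2) ℝ) :
    frobSq A = A 0 0 ^ 2 + A 0 1 ^ 2 + A 1 0 ^ 2 + A 1 1 ^ 2 := by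
  simp only [frobSq, Fin.sum_univ_two]; ring

lemma sv2_nonneg (A : Matrix (Fin 2) (Fin 2) ℝ) : 0 ≤ sv2 A := Real.sqrt_nonneg _

/-- `α₂²` is the smaller root of the characteristic polynomial of `AAᵀ`. -/
lemma sv2_sq_spec (A : Matrix (Fin 2) (Fin 2) ℝ) :
    (sv2 A ^ 2) ^ 2 - frobSq A * sv2 A ^ 2 + A.det ^ 2 = 0 ∧ 2 * sv2 A ^ 2 ≤ frobSq A := by
  have hF : 0 ≤ frobSq A := by rw [frobSq_eq]; positivity
  have hdisc : 0 ≤ frobSq A ^ 2 - 4 * A.det ^ 2 := by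
    have h : frobSq A ^ 2 - 4 * A.det ^ 2 =
        ((A 0 0 + A 1 1) ^ 2 + (A 0 1 - A 1 0) ^ 2) *
          ((A 0 0 - A 1 1) ^ 2 + (A 0 1 + A 1 0) ^ 2) := by
      rw [frobSq_eq, Matrix.det_fin_two]; ring
    rw [h]; positivity
  have hs := Real.sq_sqrt hdisc
  have hs0 := Real.sqrt_nonneg (frobSq A ^ 2 - 4 * A.det ^ 2)
  have hle : Real.sqrt (frobSq A ^ 2 - 4 * A.det ^ 2) ≤ frobSq A :=
    Real.sqrt_le_iff.mpr ⟨hF, by nlinarith [sq_nonneg A.det]⟩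
  have hsv : sv2 A ^ 2 = (frobSq A - Real.sqrt (frobSq A ^ 2 - 4 * A.det ^ 2)) / 2 :=
    Real.sq_sqrt (by linarith)
  rw [hsv]
  constructor <;> nlinarith

lemma sv2_sq_mul_le (A : Matrix (Fin 2) (Fin 2) ℝ) (u v : ℝ) :
    sv2 A ^ 2 * (u ^ 2 + v ^ 2) ≤
      (u * A 0 0 + v * A 1 0) ^ 2 + (u * A 0 1 + v * A 1 1) ^ 2 := by
  obtain ⟨h1, h2⟩ := sv2_sq_spec A
  rw [frobSq_eq] at h1 h2
  rw [Matrix.det_fin_two] at h1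
  set l := sv2 A ^ 2
  set p := A 0 0 ^ 2 + A 0 1 ^ 2 - l with hp
  set q := A 0 0 * A 1 0 + A 0 1 * A 1 1 with hq
  set s := A 1 0 ^ 2 + A 1 1 ^ 2 - l with hs
  have hdet : p * s = q ^ 2 := by rw [hp, hq, hs]; linear_combination h1
  have hsum : 0 ≤ p + s := by rw [hp, hs]; linarith
  have key : 0 ≤ p * u ^ 2 + 2 * q * u * v + s * v ^ 2 := by
    rcases hsum.eq_or_lt with h0 | h0
    · have hp0 : p = 0 := by nlinarith [sq_nonneg p, sq_nonneg q]
      have hs0 : s = 0 := by linarith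
      have hq0 : q = 0 := by
        rw [hp0, hs0] at hdet
        exact pow_eq_zero_iff (two_ne_zero) |>.mp (by linarith)
      simp [hp0, hs0, hq0]
    · have : (p + s) * (p * u ^ 2 + 2 * q * u * v + s * v ^ 2) =
          (p * u + q * v) ^ 2 + (q * u + s * v) ^ 2 := by
        linear_combination (u ^ 2 + v ^ 2) * hdet
      exact nonneg_of_mul_nonneg_right (by rw [this]; positivity) h0
  have : (u * A 0 0 + v * A 1 0) ^ 2 + (u * A 0 1 + v * A 1 1) ^ 2 - l * (u ^ 2 + v ^ 2) =
      p * u ^ 2 + 2 * q * u * v + s * v ^ 2 := by rw [hp, hq, hs]; ring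
  linarith

lemma exists_sv2_sq_mul_eq (A : Matrix (Fin 2) (Fin 2) ℝ) :
    ∃ u v : ℝ, 0 < u ^ 2 + v ^ 2 ∧
      (u * A 0 0 + v * A 1 0) ^ 2 + (u * A 0 1 + v * A 1 1) ^ 2 =
        sv2 A ^ 2 * (u ^ 2 + v ^ 2) := by
  obtain ⟨h1, -⟩ := sv2_sq_spec A
  rw [frobSq_eq, Matrix.det_fin_two] at h1
  set l := sv2 A ^ 2
  by_cases hp : A 0 0 ^ 2 + A 0 1 ^ 2 = l
  · exact ⟨1, 0, by norm_num, by linear_combination hp⟩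
  · refine ⟨A 0 0 * A 1 0 + A 0 1 * A 1 1, l - (A 0 0 ^ 2 + A 0 1 ^ 2), ?_, ?_⟩
    · have : l - (A 0 0 ^ 2 + A 0 1 ^ 2) ≠ 0 := fun h => hp (by linarith)
      positivity
    · linear_combination (A 0 0 ^ 2 + A 0 1 ^ 2 - l) * h1

lemma sv2_mul_sq_le (A B : Matrix (Fin 2) (Fin 2) ℝ) :
    sv2 (A * B) ^ 2 ≤ sv2 A ^ 2 * frobSq B := by
  obtain ⟨u, v, hpos, huv⟩ := exists_sv2_sq_mul_eq A
  have h := sv2_sq_mul_le (A * B) u v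
  simp only [Matrix.mul_apply, Fin.sum_univ_two] at h
  set s := u * A 0 0 + v * A 1 0 with hs
  set t := u * A 0 1 + v * A 1 1 with ht
  have e : ∀ j : Fin 2, u * (A 0 0 * B 0 j + A 0 1 * B 1 j) +
      v * (A 1 0 * B 0 j + A 1 1 * B 1 j) = s * B 0 j + t * B 1 j := by
    intro j; rw [hs, ht]; ring
  rw [e, e] at h
  have hB : (s * B 0 0 + t * B 1 0) ^ 2 + (s * B 0 1 + t * B 1 1) ^ 2 ≤
      (s ^ 2 + t ^ 2) * frobSq B := by
    rw [frobSq_eq]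
    nlinarith [sq_nonneg (s * B 1 0 - t * B 0 0), sq_nonneg (s * B 1 1 - t * B 0 1)]
  refine le_of_mul_le_mul_right (h.trans (hB.trans (le_of_eq ?_))) hpos
  rw [huv]; ring

/-! ### Words, compositions and Jacobians -/

lemma word_succ {I : Type} (ii : ℕ → I) (n : ℕ) : word ii (n + 1) = word ii n ++ [ii n] := by
  simp only [word, List.ofFn_succ', List.concat_eq_append]
  rfl

lemma word_succ_cons {I : Type} (ii : ℕ → I) (n : ℕ) : word ii (n + 1) = ii 0 :: word (shift ii) n := by
  simp only [word, List.ofFn_succ]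
  rfl

lemma exists_word_eq {I : Type} [Nonempty I] (w : List I) : ∃ ll : ℕ → I, word ll w.length = w := by
  obtain ⟨i₀⟩ := ‹Nonempty I›
  refine ⟨fun k => w.getD k i₀, ?_⟩
  apply List.ext_getElem
  · simp [word]
  · intro k h1 h2
    simp [word]

lemma length_word {I : Type} (ii : ℕ → I) (n : ℕ) : (word ii n).length = n := by simp [word]

variable {I : Type} [Fintype I]

lemma alpha2_nonneg (T : System I) (w : List I) (a : ℝ × ℝ) : 0 ≤ alpha2 T w a := sv2_nonneg _

lemma S_mem_sq (T : System I) (i : I) {a : ℝ × ℝ} (ha : a ∈ sq) : S T i a ∈ sq :=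
  T.mapsTo i ha

lemma Sw_mem_sq (T : System I) (w : List I) {a : ℝ × ℝ} (ha : a ∈ sq) : Sw T w a ∈ sq := by
  induction w with
  | nil => exact ha
  | cons i w ih => exact S_mem_sq T i ih

lemma Sw_append_singleton (T : System I) (w : List I) (i : I) (a : ℝ × ℝ) :
    Sw T (w ++ [i]) a = Sw T w (S T i a) := by
  induction w with
  | nil => rfl
  | cons j w ih => simp [Sw, ih]

lemma Dmat_cons (T : System I) (i : I) (w : List I) (a : ℝ × ℝ) :
    Dmat T (i :: w) a = Dmat T [i] (Sw T w a) * Dmat T w a := by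
  ext j k
  fin_cases j <;> fin_cases k <;>
    simp [Dmat, fxw, gxw, gyw, Sw, Matrix.mul_apply, Fin.sum_univ_two]

lemma Dmat_append_singleton (T : System I) (w : List I) (i : I) (a : ℝ × ℝ) :
    Dmat T (w ++ [i]) a = Dmat T w (S T i a) * Dmat T [i] a := by
  induction w with
  | nil =>
    have h : Dmat T [] (S T i a) = 1 := by
      ext j k; fin_cases j <;> fin_cases k <;> simp [Dmat, fxw, gxw, gyw]
    simp [h]
  | cons j w ih =>
    rw [List.cons_append, Dmat_cons, ih, Dmat_cons T j w, Sw_append_singleton, Matrix.mul_assoc]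

lemma IsAttractor.subset_iUnion_Sw {T : System I} {F : Set (ℝ × ℝ)} (hF : IsAttractor T F)
    (n : ℕ) {y : ℝ × ℝ} (hy : y ∈ F) : ∃ w : List I, w.length = n ∧ y ∈ Sw T w '' F := by
  induction n generalizing y with
  | zero => exact ⟨[], rfl, y, hy, rfl⟩
  | succ n ih =>
    rw [hF.2.2.2] at hy
    obtain ⟨i, z, hz, rfl⟩ := mem_iUnion.mp hy
    obtain ⟨w, hw, x, hx, rfl⟩ := ih hz
    exact ⟨i :: w, by simp [hw], x, hx, rfl⟩

/-! ### Contraction -/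

lemma exists_dE_Sw_le (T : System I) : ∃ c, 0 ≤ c ∧ c < 1 ∧ ∀ (w : List I),
    ∀ a ∈ sq, ∀ b ∈ sq, dE (Sw T w a) (Sw T w b) ≤ c ^ w.length * dE a b := by
  obtain ⟨c, hc0, hc1, hc⟩ := T.contracting
  refine ⟨c, hc0, hc1, fun w a ha b hb => ?_⟩
  induction w with
  | nil => simp [Sw]
  | cons i w ih =>
    have h := (hc i).2.2 _ (Sw_mem_sq T w ha) _ (Sw_mem_sq T w hb)
    calc dE (Sw T (i :: w) a) (Sw T (i :: w) b) ≤ c * dE (Sw T w a) (Sw T w b) := h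
      _ ≤ c * (c ^ w.length * dE a b) := by gcongr
      _ = c ^ (i :: w).length * dE a b := by rw [List.length_cons]; ring

lemma IsCoding.mem_sq {T : System I} {Pi : (ℕ → I) → ℝ × ℝ} (hPi : IsCoding T Pi)
    (ii : ℕ → I) : Pi ii ∈ sq := by
  obtain ⟨a, ha, h⟩ := hPi ii 0
  rw [← h]
  exact Sw_mem_sq T _ ha

lemma IsCoding.eq_S_shift {T : System I} {Pi : (ℕ → I) → ℝ × ℝ} (hPi : IsCoding T Pi)
    (ii : ℕ → I) : Pi ii = S T (ii 0) (Pi (shift ii)) := by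
  obtain ⟨c, hc0, hc1, hc⟩ := exists_dE_Sw_le T
  apply eq_of_dE_eq_zero
  refine le_antisymm ?_ (dE_nonneg _ _)
  have hlim : Tendsto (fun n : ℕ => c ^ (n + 1) * 2) atTop (nhds 0) := by
    have h := ((tendsto_pow_atTop_nhds_zero_of_lt_one hc0 hc1).comp
      (tendsto_add_atTop_nat 1)).mul_const 2
    simpa using h
  refine ge_of_tendsto' hlim fun n => ?_
  obtain ⟨a, ha, ha'⟩ := hPi ii (n + 1)
  obtain ⟨b, hb, hb'⟩ := hPi (shift ii) n
  have e : S T (ii 0) (Pi (shift ii)) = Sw T (word ii (n + 1)) b := by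
    rw [word_succ_cons, ← hb']; rfl
  rw [e, ← ha']
  refine (hc _ a ha b hb).trans ?_
  rw [length_word]
  exact mul_le_mul_of_nonneg_left (dE_le_two_of_mem_sq ha hb) (pow_nonneg hc0 _)

lemma sq_add_sq_le_of_hasDerivWithinAt {f g : ℝ → ℝ} {f' g' x : ℝ}
    (hx : x ∈ Icc (0 : ℝ) 1) (hf : HasDerivWithinAt f f' (Icc 0 1) x)
    (hg : HasDerivWithinAt g g' (Icc 0 1) x)
    (h : ∀ y ∈ Icc (0 : ℝ) 1, (f y - f x) ^ 2 + (g y - g x) ^ 2 ≤ (y - x) ^ 2) :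
    f' ^ 2 + g' ^ 2 ≤ 1 := by
  have hne : (nhdsWithin x (Icc (0 : ℝ) 1 \ {x})).NeBot := by
    rw [← accPt_principal_iff_nhdsWithin]
    exact (isPreconnected_Icc).preperfect_of_nontrivial
      ⟨0, by simp, 1, by simp, by simp⟩ x hx
  have hf' := hasDerivWithinAt_iff_tendsto_slope.mp hf
  have hg' := hasDerivWithinAt_iff_tendsto_slope.mp hg
  refine le_of_tendsto ((hf'.pow 2).add (hg'.pow 2)) ?_
  filter_upwards [self_mem_nhdsWithin] with y hy
  have hyx : y - x ≠ 0 := sub_ne_zero.mpr hy.2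
  rw [slope_def_field, slope_def_field, div_pow, div_pow, ← add_div]
  exact div_le_one_of_le₀ (h y hy.1) (sq_nonneg _)

lemma frobSq_Dmat_singleton_le (T : System I) (i : I) {a : ℝ × ℝ} (ha : a ∈ sq) :
    frobSq (Dmat T [i] a) ≤ 2 := by
  obtain ⟨c, hc0, hc1, hc⟩ := T.contracting
  have hS : ∀ b ∈ sq, (T.f i b.1 - T.f i a.1) ^ 2 + (T.g i b - T.g i a) ^ 2 ≤
      (b.1 - a.1) ^ 2 + (b.2 - a.2) ^ 2 := by
    intro b hb
    have h : dE (T.f i b.1, T.g i b) (T.f i a.1, T.g i a) ≤ dE b a :=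
      ((hc i).2.2 b hb a ha).trans (mul_le_of_le_one_left (dE_nonneg _ _) hc1.le)
    have h2 := pow_le_pow_left₀ (dE_nonneg _ _) h 2
    rwa [dE_sq, dE_sq] at h2
  have hg := T.hasDeriv_g i a ha
  have hx : HasDerivWithinAt (fun t => T.g i (t, a.2)) (T.gx i a) (Icc 0 1) a.1 := by
    have h := HasFDerivWithinAt.comp_hasDerivWithinAt (t := sq) (f := fun t : ℝ => (t, a.2)) a.1
      hg ((hasDerivWithinAt_id a.1 (Icc 0 1)).prodMk (hasDerivWithinAt_const a.1 (Icc 0 1) a.2))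
      (fun t ht => ⟨ht, ha.2⟩)
    simpa [Function.comp_def] using h
  have hy : HasDerivWithinAt (fun t => T.g i (a.1, t)) (T.gy i a) (Icc 0 1) a.2 := by
    have h := HasFDerivWithinAt.comp_hasDerivWithinAt (t := sq) (f := fun t : ℝ => (a.1, t)) a.2
      hg ((hasDerivWithinAt_const a.2 (Icc 0 1) a.1).prodMk (hasDerivWithinAt_id a.2 (Icc 0 1)))
      (fun t ht => ⟨ha.1, ht⟩)
    simpa [Function.comp_def] using h
  have col1 : T.fx i a.1 ^ 2 + T.gx i a ^ 2 ≤ 1 :=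
    sq_add_sq_le_of_hasDerivWithinAt ha.1 (T.hasDeriv_f i a.1 ha.1) hx
      fun t ht => by simpa using hS (t, a.2) ⟨ht, ha.2⟩
  have col2 : (0 : ℝ) ^ 2 + T.gy i a ^ 2 ≤ 1 :=
    sq_add_sq_le_of_hasDerivWithinAt ha.2 (hasDerivWithinAt_const a.2 (Icc 0 1) (0 : ℝ)) hy
      fun t ht => by simpa using hS (a.1, t) ⟨ha.1, ht⟩
  rw [frobSq_eq]
  simp only [Dmat, fxw, gxw, gyw, Sw, Matrix.of_apply, Matrix.cons_val', Matrix.cons_val_zero,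
    Matrix.cons_val_one, Matrix.cons_val_fin_one]
  linarith

lemma IsCoding.alpha2_word_succ_sq_le {T : System I} {Pi : (ℕ → I) → ℝ × ℝ}
    (hPi : IsCoding T Pi) (ii : ℕ → I) (n : ℕ) :
    alpha2 T (word ii (n + 1)) (Pi (shiftn ii (n + 1))) ^ 2 ≤
      2 * alpha2 T (word ii n) (Pi (shiftn ii n)) ^ 2 := by
  have hshift : shift (shiftn ii n) = shiftn ii (n + 1) := by
    funext k
    simp only [shift, shiftn]
    congr 1
    omega
  have hPin : Pi (shiftn ii n) = S T (ii n) (Pi (shiftn ii (n + 1))) := by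
    rw [hPi.eq_S_shift (shiftn ii n), hshift]
    simp [shiftn]
  rw [alpha2, alpha2, word_succ, Dmat_append_singleton, ← hPin, mul_comm]
  exact (sv2_mul_sq_le _ _).trans
    (mul_le_mul_of_nonneg_left (frobSq_Dmat_singleton_le T _ (hPi.mem_sq _)) (sq_nonneg _))

lemma two_mul_dE_sq_lt_of_mem_Q2 {x y : ℝ × ℝ} {r : ℝ} (hy : y ∈ Q2 x r) :
    2 * dE x y ^ 2 < r ^ 2 := by
  obtain ⟨⟨h1, h2⟩, h3, h4⟩ := hy
  rw [dE_sq]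
  nlinarith

end FFL

/-- the square `Q₂(x, θ·α₂)` meets no level-`n` cylinder other than
`S_{i|n}([0,1]²)`, hence its intersection with `F` lies in the approximate square. -/
theorem stmt17 {I : Type} [Fintype I] (T : System I)
    (F : Set (ℝ × ℝ)) (hF : IsAttractor T F) (hSSC : SSC T F)
    (Pi : (ℕ → I) → ℝ × ℝ) (hPi : IsCoding T Pi)
    (θ : ℝ) (hθ : 0 < θ)
    (hsep : ∀ (ii ll : ℕ → I) (n : ℕ), word ii n ≠ word ll n →
      ∀ a ∈ sq, ∀ b ∈ sq,
        θ * alpha2 T (word ii (n-1)) (Pi (shiftn ii (n-1))) ≤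
          dE (Sw T (word ii n) a) (Sw T (word ll n) b))
    (ii : ℕ → I) (n : ℕ) :
    (∀ w : List I, w.length = n → w ≠ word ii n →
      Q2 (Pi ii) (θ * alpha2 T (word ii n) (Pi (shiftn ii n))) ∩ Sw T w '' sq = ∅) ∧
    Q2 (Pi ii) (θ * alpha2 T (word ii n) (Pi (shiftn ii n))) ∩ F ⊆
      Bn T (word ii n) (Pi ii) (θ * alpha2 T (word ii n) (Pi (shiftn ii n))) := by
  have hdisj : ∀ w : List I, w.length = n → w ≠ word ii n →
      Q2 (Pi ii) (θ * alpha2 T (word ii n) (Pi (shiftn ii n))) ∩ Sw T w '' sq = ∅ := by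
    rintro w rfl hw
    have : Nonempty I := Fintype.card_pos_iff.mp (by have := T.card2; omega)
    obtain ⟨ll, hll⟩ := exists_word_eq w
    rw [eq_empty_iff_forall_notMem]
    rintro _ ⟨hQ, b, hb, rfl⟩
    obtain ⟨m, hm⟩ : ∃ m, w.length = m + 1 := by
      refine Nat.exists_eq_succ_of_ne_zero fun h0 => hw ?_
      rw [List.length_eq_zero_iff.mp h0]
      rfl
    obtain ⟨a, ha, hPa⟩ := hPi ii w.length
    have hd := hsep ii ll w.length (by rw [hll]; exact hw.symm) a ha b hb
    rw [hll, hPa] at hd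
    have hlt := two_mul_dE_sq_lt_of_mem_Q2 hQ
    rw [hm] at hd hlt
    rw [Nat.add_sub_cancel] at hd
    have hle := mul_le_mul_of_nonneg_left (hPi.alpha2_word_succ_sq_le ii m) (sq_nonneg θ)
    have hsq := pow_le_pow_left₀ (mul_nonneg hθ.le (alpha2_nonneg T _ _)) hd 2
    rw [mul_pow] at hsq hlt
    linarith
  refine ⟨hdisj, ?_⟩
  rintro y ⟨hyQ, hyF⟩
  obtain ⟨w, hw, z, hz, rfl⟩ := hF.subset_iUnion_Sw n hyF
  have hmem : Sw T w z ∈ Sw T w '' sq := ⟨z, hF.2.2.1 hz, rfl⟩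
  have hww : w = word ii n := by
    by_contra hne
    have : Sw T w z ∈ (∅ : Set (ℝ × ℝ)) := hdisj w hw hne ▸ ⟨hyQ, hmem⟩
    exact this
  refine ⟨hww ▸ hmem, abs_le.mpr ⟨?_, ?_⟩⟩
  · linarith [hyQ.1.1]
  · linarith [hyQ.1.2]
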